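/- Let B1 be the set of real numbers [0; a1, a2, …] whose continued fraction partial quotients all lie in {1,2} and whose digit sequence contains none of the following fourteen strings, nor their reverses, as a consecutive substring: 21212, 21112121, 211121222, 111112121, 12111212, 111212111, 21112122112, 222111212211, 12211112121122, 112211121221111, 22111121211221, 21122111212211, 2111212211112, 22221111212112222. Then 0.50001 < dim_H B1 < 0.50005. -/

import Mathlib

open Filter

/-- Numerators of the convergents of the continued fraction `[a 0; a 1, a 2, …]`. -/
def cfNum (a : ℕ → ℕ) : ℕ → ℕ
  | 0 => a 0
  | 1 => a 1 * a 0 + 1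
  | n + 2 => a (n + 2) * cfNum a (n + 1) + cfNum a n

/-- Denominators of the convergents of the continued fraction `[a 0; a 1, a 2, …]`. -/
def cfDen (a : ℕ → ℕ) : ℕ → ℕ
  | 0 => 1
  | 1 => a 1
  | n + 2 => a (n + 2) * cfDen a (n + 1) + cfDen a n

/-- Value of the infinite continued fraction `[a 0; a 1, a 2, …]` (the limit of its
convergents). -/
noncomputable def cfVal (a : ℕ → ℕ) : ℝ :=
  limUnder atTop fun n => (cfNum a n : ℝ) / (cfDen a n)

/-- Value of the infinite continued fraction `[0; a 0, a 1, …]`. -/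
noncomputable def cf01 (a : ℕ → ℕ) : ℝ := 1 / cfVal a

/-- `λ₀(α) = [α 0; α 1, α 2, …] + [0; α (-1), α (-2), …]`. -/
noncomputable def lambda0 (α : ℤ → ℕ) : ℝ :=
  cfVal (fun n : ℕ => α (n : ℤ)) + cf01 (fun n : ℕ => α (-((n : ℤ) + 1)))

/-- The shift `σ^N` on bi-infinite sequences. -/
def shiftZ (N : ℤ) (α : ℤ → ℕ) : ℤ → ℕ := fun i => α (i + N)

/-- The Markov value `m(α) = sup_{n ∈ ℤ} λ₀(σⁿ α)`. -/
noncomputable def markovValue (α : ℤ → ℕ) : ℝ := ⨆ n : ℤ, lambda0 (shiftZ n α)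

/-- The Lagrange value `ℓ(α) = limsup_{n → +∞} λ₀(σⁿ α)`. -/
noncomputable def lagrangeValue (α : ℤ → ℕ) : ℝ :=
  limsup (fun n : ℕ => lambda0 (shiftZ (n : ℤ) α)) atTop

/-- The Markov spectrum `M`. -/
def MarkovSpectrum : Set ℝ :=
  { x | ∃ α : ℤ → ℕ, (∀ i, 1 ≤ α i) ∧ markovValue α = x }

/-- The Lagrange spectrum `L`. -/
def LagrangeSpectrum : Set ℝ :=
  { x | ∃ α : ℤ → ℕ, (∀ i, 1 ≤ α i) ∧ lagrangeValue α = x }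

/-- The finite word `w` occurs in the one-sided sequence `a` starting at position `i`. -/
def occursAtN (a : ℕ → ℕ) (i : ℕ) (w : List ℕ) : Prop :=
  ∀ j < w.length, a (i + j) = w.getD j 0

/-- The Gauss–Cantor set of reals `[0; a₁, a₂, …]` whose partial quotients all lie in `D`
and whose digit sequence contains no word of `F`, nor the reverse of a word of `F`, as a
consecutive substring. -/
noncomputable def gaussCantorRev (D : Set ℕ) (F : List (List ℕ)) : Set ℝ :=
  { x | ∃ a : ℕ → ℕ, (∀ n, a n ∈ D) ∧
      (∀ w ∈ F, ∀ i, ¬ occursAtN a i w ∧ ¬ occursAtN a i w.reverse) ∧ x = cf01 a }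

/-- The Gauss–Cantor set of reals `[0; a₁, a₂, …]` whose partial quotients all lie in `D`
and whose digit sequence contains no word of `F` as a consecutive substring. -/
noncomputable def gaussCantor (D : Set ℕ) (F : List (List ℕ)) : Set ℝ :=
  { x | ∃ a : ℕ → ℕ, (∀ n, a n ∈ D) ∧ (∀ w ∈ F, ∀ i, ¬ occursAtN a i w) ∧ x = cf01 a }

/-- The 14 forbidden words defining the Cantor set `B₁`. -/
def forbiddenB1 : List (List ℕ) :=
  [[2, 1, 2, 1, 2],
   [2, 1, 1, 1, 2, 1, 2, 1],
   [2, 1, 1, 1, 2, 1, 2, 2, 2],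
   [1, 1, 1, 1, 1, 2, 1, 2, 1],
   [1, 2, 1, 1, 1, 2, 1, 2],
   [1, 1, 1, 2, 1, 2, 1, 1, 1],
   [2, 1, 1, 1, 2, 1, 2, 2, 1, 1, 2],
   [2, 2, 2, 1, 1, 1, 2, 1, 2, 2, 1, 1],
   [1, 2, 2, 1, 1, 1, 1, 2, 1, 2, 1, 1, 2, 2],
   [1, 1, 2, 2, 1, 1, 1, 2, 1, 2, 2, 1, 1, 1, 1],
   [2, 2, 1, 1, 1, 1, 2, 1, 2, 1, 1, 2, 2, 1],
   [2, 1, 1, 2, 2, 1, 1, 1, 2, 1, 2, 2, 1, 1],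
   [2, 1, 1, 1, 2, 1, 2, 2, 1, 1, 1, 1, 2],
   [2, 2, 2, 2, 1, 1, 1, 1, 2, 1, 2, 1, 1, 2, 2, 2, 2]]

/-- A state of the automaton recognising the words that avoid `forbiddenB1` and its reverses.
`label` is the recent history (latest digit first), `next1` and `next2` are the indices of the
successors, `[lo, hi] / 10 ^ 6` bounds the ratio of consecutive continuants in this state, and
`weight / (slope * q + 10 ^ 4 * q')` is the approximate eigenfunction. -/
structure AutState where
  label : List ℕ
  next1 : ℕ
  next2 : ℕ
  lo : ℕ
  hi : ℕ
  weight : ℕ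
  slope : ℕ

/-- The states of the automaton; a state with weight `0` is dead. -/
def automaton : List AutState :=
  [⟨[], 0, 0, 0, 1000000, 0, 1⟩,
   ⟨[], 2, 3, 0, 1, 179590000, 17959⟩,
   ⟨[1], 4, 5, 999999, 1000000, 181265232, 18637⟩,
   ⟨[2], 6, 7, 499999, 500000, 174429955, 18761⟩,
   ⟨[1, 1], 8, 9, 500000, 500001, 177674999, 18359⟩,
   ⟨[2, 1], 10, 11, 333333, 333334, 168347162, 18875⟩,
   ⟨[1, 2], 12, 13, 666666, 666668, 158263813, 17893⟩,
   ⟨[2, 2], 14, 15, 400000, 400001, 172463680, 18654⟩,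
   ⟨[1, 1, 1], 16, 17, 666666, 666667, 175938966, 18440⟩,
   ⟨[2, 1, 1], 10, 18, 399999, 400000, 168048561, 18905⟩,
   ⟨[1, 2, 1], 19, 20, 714285, 750001, 145613428, 17540⟩,
   ⟨[2, 2, 1], 21, 15, 421052, 428572, 172465282, 18675⟩,
   ⟨[1, 1, 2], 22, 23, 599999, 600001, 174240483, 18593⟩,
   ⟨[2, 1, 2], 24, 11, 368421, 375001, 142186784, 20561⟩,
   ⟨[1, 2, 2], 25, 13, 714285, 714286, 158136054, 17927⟩,
   ⟨[2, 2, 2], 26, 27, 411764, 416667, 170841515, 18740⟩,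
   ⟨[1, 1, 1, 1], 28, 29, 599999, 600001, 174129523, 18458⟩,
   ⟨[2, 1, 1, 1], 30, 18, 374999, 375001, 165969766, 18997⟩,
   ⟨[2, 2, 1, 1], 31, 15, 416666, 421053, 171494195, 18713⟩,
   ⟨[1, 1, 2, 1], 32, 23, 571428, 583334, 172732950, 18645⟩,
   ⟨[2, 1, 2, 1], 33, 11, 363636, 368422, 123260007, 21782⟩,
   ⟨[1, 2, 2, 1], 34, 13, 699999, 703705, 157885882, 17926⟩,
   ⟨[1, 1, 1, 2], 35, 36, 624999, 625001, 165713769, 18113⟩,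
   ⟨[2, 1, 1, 2], 10, 37, 384615, 388889, 167461994, 18881⟩,
   ⟨[1, 2, 1, 2], 38, 0, 727272, 730770, 82574424, 15171⟩,
   ⟨[1, 1, 2, 2], 39, 40, 583333, 583334, 173530591, 18574⟩,
   ⟨[1, 2, 2, 2], 41, 42, 705882, 708334, 153917327, 17806⟩,
   ⟨[2, 2, 2, 2], 43, 27, 413793, 414635, 170783632, 18741⟩,
   ⟨[1, 1, 1, 1, 1], 28, 44, 615384, 625001, 170413827, 18357⟩,
   ⟨[2, 1, 1, 1, 1], 30, 45, 384615, 384616, 165783443, 18997⟩,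
   ⟨[1, 2, 1, 1, 1], 19, 46, 722221, 727274, 140393188, 17351⟩,
   ⟨[1, 2, 2, 1, 1], 47, 48, 703703, 705883, 155540125, 17862⟩,
   ⟨[1, 1, 1, 2, 1], 35, 49, 631578, 636364, 161992359, 18000⟩,
   ⟨[1, 2, 1, 2, 1], 50, 0, 730768, 733334, 49393334, 14436⟩,
   ⟨[1, 1, 2, 2, 1], 51, 52, 586956, 588236, 173102449, 18571⟩,
   ⟨[1, 1, 1, 1, 2], 28, 53, 611110, 615385, 174114349, 18465⟩,
   ⟨[2, 1, 1, 1, 2], 54, 18, 379999, 380953, 152250558, 19866⟩,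
   ⟨[2, 2, 1, 1, 2], 55, 15, 418604, 419355, 170755484, 18746⟩,
   ⟨[1, 1, 2, 1, 2], 56, 23, 577777, 578948, 159681487, 19337⟩,
   ⟨[1, 1, 1, 2, 2], 57, 36, 631578, 631580, 165387286, 18132⟩,
   ⟨[2, 1, 1, 2, 2], 58, 37, 386666, 387097, 166974966, 18909⟩,
   ⟨[1, 1, 2, 2, 2], 59, 40, 585365, 586208, 172886791, 18606⟩,
   ⟨[2, 1, 2, 2, 2], 60, 11, 369230, 369566, 136314853, 20899⟩,
   ⟨[1, 2, 2, 2, 2], 61, 42, 706896, 707318, 153835402, 17809⟩,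
   ⟨[2, 1, 1, 1, 1, 1], 62, 45, 380952, 382354, 160606891, 19304⟩,
   ⟨[2, 2, 1, 1, 1, 1], 63, 15, 419354, 420001, 171175330, 18730⟩,
   ⟨[2, 1, 2, 1, 1, 1], 64, 11, 366666, 367348, 114936735, 22526⟩,
   ⟨[1, 1, 2, 2, 1, 1], 65, 52, 586206, 586957, 172757046, 18586⟩,
   ⟨[2, 1, 2, 2, 1, 1], 66, 11, 369565, 369864, 138840995, 20747⟩,
   ⟨[2, 1, 1, 1, 2, 1], 67, 18, 379310, 380001, 147090810, 20260⟩,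
   ⟨[1, 1, 2, 1, 2, 1], 68, 23, 576922, 577779, 111358048, 22545⟩,
   ⟨[1, 1, 1, 2, 2, 1], 69, 36, 629629, 630138, 165132127, 18142⟩,
   ⟨[2, 1, 1, 2, 2, 1], 70, 37, 386363, 386667, 166623419, 18928⟩,
   ⟨[2, 1, 1, 1, 1, 2], 30, 71, 382352, 382979, 165575258, 18990⟩,
   ⟨[1, 2, 1, 1, 1, 2], 19, 72, 724137, 724639, 105390655, 15974⟩,
   ⟨[1, 2, 2, 1, 1, 2], 73, 74, 704545, 704919, 153705526, 17811⟩,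
   ⟨[1, 1, 1, 2, 1, 2], 35, 75, 633333, 633804, 128056990, 16825⟩,
   ⟨[1, 1, 1, 1, 2, 2], 28, 76, 612902, 613334, 173169470, 18437⟩,
   ⟨[1, 2, 1, 1, 2, 2], 19, 77, 720930, 721155, 144270965, 17489⟩,
   ⟨[1, 1, 1, 2, 2, 2], 57, 78, 630434, 630770, 163638235, 18077⟩,
   ⟨[1, 2, 1, 2, 2, 2], 79, 0, 730158, 730338, 71995664, 14939⟩,
   ⟨[1, 1, 2, 2, 2, 2], 80, 81, 585713, 585859, 172703996, 18604⟩,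
   ⟨[1, 2, 1, 1, 1, 1, 1], 19, 82, 723403, 724139, 126774834, 16832⟩,
   ⟨[1, 2, 2, 1, 1, 1, 1], 47, 83, 704224, 704546, 154677996, 17834⟩,
   ⟨[1, 2, 1, 2, 1, 1, 1], 84, 0, 731342, 731708, 35059664, 13953⟩,
   ⟨[1, 1, 1, 2, 2, 1, 1], 69, 85, 630136, 630436, 164227389, 18114⟩,
   ⟨[1, 2, 1, 2, 2, 1, 1], 86, 0, 729999, 730159, 76556794, 15045⟩,
   ⟨[1, 2, 1, 1, 1, 2, 1], 19, 0, 724637, 725001, 92639069, 15363⟩,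
   ⟨[1, 1, 1, 2, 1, 2, 1], 87, 0, 633802, 634147, 34507561, 13958⟩,
   ⟨[1, 1, 1, 1, 2, 2, 1], 28, 88, 613332, 613637, 172499887, 18417⟩,
   ⟨[1, 2, 1, 1, 2, 2, 1], 19, 89, 721153, 721312, 143341643, 17456⟩,
   ⟨[2, 2, 1, 1, 1, 1, 2], 90, 15, 419642, 419754, 170902905, 18744⟩,
   ⟨[2, 1, 2, 1, 1, 1, 2], 0, 91, 367021, 367089, 36538968, 26715⟩,
   ⟨[1, 1, 2, 2, 1, 1, 2], 92, 52, 586538, 586667, 172444120, 18601⟩,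
   ⟨[2, 1, 2, 2, 1, 1, 2], 93, 11, 369696, 369748, 136320396, 20900⟩,
   ⟨[2, 1, 1, 1, 2, 1, 2], 0, 18, 379678, 379747, 91642361, 25344⟩,
   ⟨[2, 1, 1, 1, 1, 2, 2], 94, 71, 382652, 382717, 164287103, 19063⟩,
   ⟨[2, 1, 2, 1, 1, 2, 2], 95, 11, 367491, 367522, 121149320, 21954⟩,
   ⟨[2, 1, 1, 1, 2, 2, 2], 96, 18, 380116, 380166, 149847197, 20043⟩,
   ⟨[1, 1, 2, 1, 2, 2, 2], 97, 23, 577921, 577982, 145767918, 20246⟩,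
   ⟨[1, 1, 1, 2, 2, 2, 2], 98, 78, 630573, 630632, 163531754, 18081⟩,
   ⟨[2, 1, 1, 2, 2, 2, 2], 99, 37, 386718, 386741, 166830503, 18917⟩,
   ⟨[2, 1, 2, 1, 1, 1, 1, 1], 0, 11, 367088, 367188, 92349220, 25355⟩,
   ⟨[2, 1, 2, 2, 1, 1, 1, 1], 100, 11, 369747, 369792, 137474293, 20829⟩,
   ⟨[1, 1, 2, 1, 2, 1, 1, 1], 0, 23, 577464, 577587, 88690093, 25296⟩,
   ⟨[2, 1, 1, 1, 2, 2, 1, 1], 101, 18, 380165, 380209, 150998055, 19956⟩,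
   ⟨[1, 1, 2, 1, 2, 2, 1, 1], 102, 23, 577981, 578036, 151742376, 19820⟩,
   ⟨[1, 1, 1, 1, 2, 1, 2, 1], 0, 53, 611940, 612070, 87188640, 25266⟩,
   ⟨[2, 1, 1, 1, 1, 2, 2, 1], 103, 71, 382608, 382654, 163383591, 19117⟩,
   ⟨[2, 1, 2, 1, 1, 2, 2, 1], 104, 11, 367469, 367492, 119656831, 22081⟩,
   ⟨[1, 2, 2, 1, 1, 1, 1, 2], 47, 105, 704347, 704403, 153948985, 17810⟩,
   ⟨[2, 2, 1, 2, 1, 1, 1, 2], 106, 0, 422459, 422472, 54415304, 14892⟩,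
   ⟨[1, 1, 1, 2, 2, 1, 1, 2], 69, 107, 630251, 630304, 163383236, 18087⟩,
   ⟨[1, 2, 1, 2, 2, 1, 1, 2], 108, 0, 730061, 730090, 71995664, 14939⟩,
   ⟨[1, 2, 1, 1, 1, 1, 2, 2], 19, 109, 723213, 723248, 136999042, 17227⟩,
   ⟨[1, 2, 1, 2, 1, 1, 2, 2], 110, 0, 731249, 731267, 45766057, 14336⟩,
   ⟨[1, 2, 1, 1, 1, 2, 2, 2], 19, 111, 724550, 724577, 99442700, 15700⟩,
   ⟨[1, 1, 1, 2, 1, 2, 2, 2], 35, 0, 633720, 633746, 94293264, 15416⟩,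
   ⟨[1, 1, 1, 1, 2, 2, 2, 2], 28, 112, 613259, 613282, 172894123, 18429⟩,
   ⟨[1, 2, 1, 1, 2, 2, 2, 2], 19, 113, 721115, 721128, 143884012, 17475⟩,
   ⟨[1, 2, 1, 2, 2, 1, 1, 1, 1], 114, 0, 730037, 730062, 74083798, 14989⟩,
   ⟨[1, 2, 1, 1, 1, 2, 2, 1, 1], 19, 115, 724527, 724552, 102299579, 15834⟩,
   ⟨[1, 1, 1, 2, 1, 2, 2, 1, 1], 35, 116, 633699, 633722, 108704895, 16076⟩,
   ⟨[1, 2, 1, 1, 1, 1, 2, 2, 1], 19, 117, 723246, 723271, 134604342, 17138⟩,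
   ⟨[1, 2, 1, 2, 1, 1, 2, 2, 1], 118, 0, 731265, 731279, 43204231, 14258⟩,
   ⟨[2, 1, 2, 2, 1, 1, 1, 1, 2], 119, 11, 369767, 369776, 136320396, 20900⟩,
   ⟨[1, 2, 2, 1, 2, 1, 1, 1, 2], 120, 13, 703001, 703008, 111242126, 20443⟩,
   ⟨[2, 1, 1, 1, 2, 2, 1, 1, 2], 121, 18, 380184, 380192, 149847197, 20043⟩,
   ⟨[1, 1, 2, 1, 2, 2, 1, 1, 2], 122, 23, 578004, 578015, 145767918, 20246⟩,
   ⟨[2, 1, 2, 1, 1, 1, 1, 2, 2], 123, 11, 367208, 367214, 109215533, 23043⟩,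
   ⟨[1, 1, 2, 1, 2, 1, 1, 2, 2], 124, 23, 577611, 577618, 105549156, 23062⟩,
   ⟨[2, 1, 2, 1, 1, 1, 2, 2, 2], 0, 125, 367029, 367034, 19834122, 27132⟩,
   ⟨[2, 1, 1, 1, 1, 2, 2, 2, 2], 126, 71, 382660, 382664, 163911223, 19085⟩,
   ⟨[2, 1, 2, 1, 1, 2, 2, 2, 2], 127, 11, 367494, 367497, 120531207, 22006⟩,
   ⟨[1, 1, 2, 1, 2, 2, 1, 1, 1, 1], 128, 23, 578013, 578023, 148497674, 20044⟩,
   ⟨[2, 1, 2, 1, 1, 1, 2, 2, 1, 1], 0, 129, 367032, 367037, 27887334, 26887⟩,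
   ⟨[2, 1, 1, 1, 2, 1, 2, 2, 1, 1], 0, 130, 379690, 379695, 41296798, 26628⟩,
   ⟨[2, 1, 2, 1, 1, 1, 1, 2, 2, 1], 131, 11, 367205, 367209, 105209916, 23470⟩,
   ⟨[1, 1, 2, 1, 2, 1, 1, 2, 2, 1], 132, 23, 577607, 577613, 101474943, 23487⟩,
   ⟨[1, 2, 1, 2, 2, 1, 1, 1, 1, 2], 133, 0, 730046, 730052, 71995664, 14939⟩,
   ⟨[1, 1, 2, 2, 1, 2, 1, 1, 1, 2], 134, 0, 587196, 587199, 66923832, 15020⟩,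
   ⟨[1, 2, 1, 1, 1, 2, 2, 1, 1, 2], 19, 135, 724536, 724542, 99442700, 15700⟩,
   ⟨[1, 1, 1, 2, 1, 2, 2, 1, 1, 2], 35, 0, 633707, 633712, 94293264, 15416⟩,
   ⟨[1, 2, 1, 2, 1, 1, 1, 1, 2, 2], 136, 0, 731414, 731418, 26263377, 13872⟩,
   ⟨[1, 1, 1, 2, 1, 2, 1, 1, 2, 2], 137, 0, 633867, 633870, 25696061, 13876⟩,
   ⟨[2, 2, 1, 2, 1, 1, 1, 2, 2, 2], 138, 0, 422469, 422471, 27811829, 14022⟩,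
   ⟨[1, 2, 1, 1, 1, 1, 2, 2, 2, 2], 19, 139, 723241, 723244, 136005075, 17190⟩,
   ⟨[1, 2, 1, 2, 1, 1, 2, 2, 2, 2], 140, 0, 731263, 731265, 44706015, 14305⟩,
   ⟨[1, 1, 1, 2, 1, 2, 2, 1, 1, 1, 1], 35, 141, 633704, 633709, 100860974, 15730⟩,
   ⟨[2, 2, 1, 2, 1, 1, 1, 2, 2, 1, 1], 142, 0, 422469, 422470, 40493555, 14520⟩,
   ⟨[2, 2, 1, 1, 1, 2, 1, 2, 2, 1, 1], 143, 0, 420221, 420223, 62306592, 15087⟩,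
   ⟨[1, 2, 1, 2, 1, 1, 1, 1, 2, 2, 1], 144, 0, 731417, 731420, 20049497, 13792⟩,
   ⟨[1, 1, 1, 2, 1, 2, 1, 1, 2, 2, 1], 145, 0, 633869, 633872, 19483200, 13796⟩,
   ⟨[1, 1, 2, 1, 2, 2, 1, 1, 1, 1, 2], 146, 23, 578017, 578020, 145767918, 20246⟩,
   ⟨[1, 1, 1, 2, 2, 1, 2, 1, 1, 1, 2], 147, 36, 630040, 630042, 133311247, 19919⟩,
   ⟨[2, 1, 2, 1, 1, 1, 2, 2, 1, 1, 2], 0, 148, 367034, 367035, 19834122, 27132⟩,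
   ⟨[1, 1, 2, 1, 2, 1, 1, 1, 1, 2, 2], 0, 149, 577561, 577563, 67834107, 25828⟩,
   ⟨[1, 1, 1, 1, 2, 1, 2, 1, 1, 2, 2], 0, 150, 612043, 612045, 66293344, 25798⟩,
   ⟨[1, 2, 2, 1, 2, 1, 1, 1, 2, 2, 2], 0, 13, 703002, 703004, 69152712, 24864⟩,
   ⟨[2, 1, 2, 1, 1, 1, 1, 2, 2, 2, 2], 151, 11, 367209, 367210, 107551972, 23213⟩,
   ⟨[1, 1, 2, 1, 2, 1, 1, 2, 2, 2, 2], 152, 23, 577612, 577613, 103857349, 23231⟩,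
   ⟨[2, 1, 1, 1, 2, 1, 2, 2, 1, 1, 1, 1], 0, 153, 379692, 379694, 19217555, 27128⟩,
   ⟨[1, 2, 2, 1, 2, 1, 1, 1, 2, 2, 1, 1], 154, 13, 703002, 703004, 89587147, 22123⟩,
   ⟨[1, 2, 2, 1, 1, 1, 2, 1, 2, 2, 1, 1], 155, 48, 704114, 704116, 122480889, 19657⟩,
   ⟨[1, 1, 2, 1, 2, 1, 1, 1, 1, 2, 2, 1], 0, 156, 577560, 577562, 52870757, 26369⟩,
   ⟨[1, 1, 1, 1, 2, 1, 2, 1, 1, 2, 2, 1], 0, 157, 612043, 612045, 51327729, 26344⟩,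
   ⟨[1, 1, 1, 2, 1, 2, 2, 1, 1, 1, 1, 2], 35, 0, 633705, 633707, 94293264, 15416⟩,
   ⟨[1, 1, 1, 1, 2, 2, 1, 2, 1, 1, 1, 2], 28, 0, 613481, 613482, 92828481, 15447⟩,
   ⟨[2, 2, 1, 2, 1, 1, 1, 2, 2, 1, 1, 2], 158, 0, 422469, 422470, 27811829, 14022⟩,
   ⟨[2, 1, 1, 2, 1, 2, 1, 1, 1, 1, 2, 2], 10, 159, 387963, 387964, 116393537, 17158⟩,
   ⟨[2, 1, 1, 1, 1, 2, 1, 2, 1, 1, 2, 2], 30, 160, 382841, 382843, 114334138, 17246⟩,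
   ⟨[1, 2, 1, 2, 1, 1, 1, 1, 2, 2, 2, 2], 161, 0, 731416, 731418, 23689744, 13843⟩,
   ⟨[1, 1, 1, 2, 1, 2, 1, 1, 2, 2, 2, 2], 162, 0, 633869, 633870, 23122726, 13847⟩,
   ⟨[2, 2, 1, 1, 1, 2, 1, 2, 2, 1, 1, 1, 1], 163, 0, 420222, 420223, 26961105, 14029⟩,
   ⟨[1, 1, 2, 2, 1, 2, 1, 1, 1, 2, 2, 1, 1], 164, 0, 587197, 587199, 30613175, 13995⟩,
   ⟨[1, 1, 2, 2, 1, 1, 1, 2, 1, 2, 2, 1, 1], 65, 0, 586814, 586816, 90662558, 15521⟩,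
   ⟨[2, 1, 1, 2, 1, 2, 1, 1, 1, 1, 2, 2, 1], 10, 0, 387963, 387964, 83014637, 15701⟩,
   ⟨[2, 1, 1, 1, 1, 2, 1, 2, 1, 1, 2, 2, 1], 30, 0, 382841, 382843, 80909976, 15763⟩,
   ⟨[1, 2, 2, 1, 2, 1, 1, 1, 2, 2, 1, 1, 2], 0, 13, 703002, 703004, 69152712, 24864⟩,
   ⟨[2, 2, 1, 1, 2, 1, 2, 1, 1, 1, 1, 2, 2], 0, 15, 418766, 418767, 91161118, 25336⟩,
   ⟨[2, 2, 1, 1, 1, 1, 2, 1, 2, 1, 1, 2, 2], 0, 15, 419666, 419668, 91161118, 25336⟩,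
   ⟨[1, 1, 2, 1, 2, 1, 1, 1, 1, 2, 2, 2, 2], 0, 165, 577561, 577562, 61644868, 26021⟩,
   ⟨[1, 1, 1, 1, 2, 1, 2, 1, 1, 2, 2, 2, 2], 0, 166, 612043, 612045, 60103194, 25992⟩,
   ⟨[1, 2, 2, 1, 1, 1, 2, 1, 2, 2, 1, 1, 1, 1], 0, 48, 704114, 704116, 66919274, 24820⟩,
   ⟨[1, 1, 1, 2, 2, 1, 2, 1, 1, 1, 2, 2, 1, 1], 0, 36, 630040, 630042, 76637391, 25034⟩,
   ⟨[2, 1, 1, 2, 1, 2, 1, 1, 1, 1, 2, 2, 2, 2], 10, 167, 387963, 387964, 102388142, 16609⟩,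
   ⟨[2, 1, 1, 1, 1, 2, 1, 2, 1, 1, 2, 2, 2, 2], 30, 168, 382841, 382843, 100308796, 16689⟩,
   ⟨[2, 2, 1, 1, 2, 1, 2, 1, 1, 1, 1, 2, 2, 2, 2], 0, 169, 418766, 418767, 55351681, 26404⟩,
   ⟨[2, 2, 1, 1, 1, 1, 2, 1, 2, 1, 1, 2, 2, 2, 2], 0, 170, 419666, 419668, 55351681, 26404⟩,
   ⟨[2, 2, 2, 1, 1, 2, 1, 2, 1, 1, 1, 1, 2, 2, 2, 2], 26, 0, 413433, 413434, 86438603, 15616⟩,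
   ⟨[2, 2, 2, 1, 1, 1, 1, 2, 1, 2, 1, 1, 2, 2, 2, 2], 26, 0, 413279, 413281, 86438603, 15616⟩]

/-- The state with index `i`; index `0` is the dead state. -/
def aut (i : ℕ) : AutState := automaton.getD i ⟨[], 0, 0, 0, 1000000, 0, 1⟩

/-- The forbidden words together with their reverses. -/
def forbiddenSym : List (List ℕ) := forbiddenB1 ++ forbiddenB1.map List.reverse

/-- All suffixes of the words in `forbiddenSym`. -/
def forbiddenTails : List (List ℕ) := forbiddenSym.flatMap List.tails

/-- Boolean test for `l` being a prefix of `m`. -/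
def isPre : List ℕ → List ℕ → Bool
  | [], _ => true
  | _ :: _, [] => false
  | a :: l, b :: m => bif Nat.beq a b then isPre l m else false

/-- The linear form `slope * q + 10 ^ 4 * q'` of the state `c`. -/
def AutState.form (c : AutState) (x y : ℕ) : ℕ := c.slope * x + 10000 * y

/-- The ratio interval of `c` is mapped into that of `v` by `r ↦ 1 / (a + r)`. -/
def AutState.mapsTo (c v : AutState) (a : ℕ) : Bool :=
  Nat.ble (v.lo * (a * 1000000 + c.hi)) (1000000 * 1000000) &&
    Nat.ble (1000000 * 1000000) (v.hi * (a * 1000000 + c.lo))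

/-- If `p`, `q` are the values of two linear forms at two vectors, the coefficients of the
product of the forms in the corresponding coordinates. -/
def mulCoeff (p q : ℕ × ℕ) : ℕ × ℕ × ℕ := (p.1 * q.1, p.1 * q.2 + p.2 * q.1, p.2 * q.2)

/-- Componentwise comparison of `k * p` and `l * q`. -/
def leCoeff (k : ℕ) (p : ℕ × ℕ × ℕ) (l : ℕ) (q : ℕ × ℕ × ℕ) : Bool :=
  Nat.ble (k * p.1) (l * q.1) && Nat.ble (k * p.2.1) (l * q.2.1) &&
    Nat.ble (k * p.2.2) (l * q.2.2)

/-- The values of the form of `v` after reading the digit `a`, at the ends of the interval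
of `c`. -/
def AutState.child (c v : AutState) (a : ℕ) : ℕ × ℕ :=
  (v.form (a * 1000000 + c.lo) 1000000, v.form (a * 1000000 + c.hi) 1000000)

/-- The arithmetic conditions: consistency of the ratio intervals, and the two-sided
approximate eigenfunction inequality. -/
def AutState.arith (c v w : AutState) : Bool :=
  let L := c.child v 1
  let R := c.child w 2
  let K := (c.form 1000000 c.lo, c.form 1000000 c.hi)
  let S := (v.weight * R.1 + w.weight * L.1, v.weight * R.2 + w.weight * L.2)
  Nat.blt c.lo c.hi && Nat.blt 0 c.slope && c.mapsTo v 1 && c.mapsTo w 2 &&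
    leCoeff 1000000 (mulCoeff S K) (1000030 * c.weight) (mulCoeff L R) &&
    leCoeff (1000025 * c.weight) (mulCoeff L R) 1000000 (mulCoeff S K)

/-- The combinatorial conditions on the transition from `c` to `v` reading `a`. -/
def AutState.trans : AutState → AutState → ℕ → List (List ℕ) → List (List ℕ) → Bool
  | ⟨u, _, _, _, _, _, _⟩, ⟨v, _, _, _, _, k, _⟩, a, F, T =>
    bif Nat.beq k 0 then F.any fun f => isPre f (a :: u)
    else isPre v (a :: u) &&
      (isPre (a :: u) v || T.all fun p => bif isPre p (a :: u) then isPre p v else true)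

/-- The combinatorial conditions at the state `c`. -/
def AutState.words (c : AutState) (F T : List (List ℕ)) : Bool :=
  bif Nat.beq c.weight 0 then true
  else (F.all fun f => !isPre f c.label) && c.trans (aut c.next1) 1 F T &&
    c.trans (aut c.next2) 2 F T

/-- Crude bounds on the coefficients of the approximate eigenfunction. -/
def AutState.small (c : AutState) : Bool :=
  Nat.ble c.weight 1000000000 && Nat.ble c.slope 1000000

theorem automaton_arith :
    (automaton.all fun c => c.arith (aut c.next1) (aut c.next2) && c.small) = true := by
  decide +kernel

theorem automaton_words :
    (automaton.all fun c => c.words forbiddenSym forbiddenTails) = true := by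
  decide +kernel

/-- All terms of the sequence lie in `{1, 2}`. -/
def IsDig (a : ℕ → ℕ) : Prop := ∀ n, a n = 1 ∨ a n = 2

/-- The sequence `a` with its first `n` terms removed. -/
def tailSeq (a : ℕ → ℕ) (n : ℕ) : ℕ → ℕ := fun k => a (n + k)

theorem IsDig.tailSeq {a : ℕ → ℕ} (h : IsDig a) (n : ℕ) : IsDig (tailSeq a n) :=
  fun k => h (n + k)

theorem IsDig.one_le {a : ℕ → ℕ} (h : IsDig a) (n : ℕ) : 1 ≤ a n := by
  rcases h n with h | h <;> omega

theorem IsDig.le_two {a : ℕ → ℕ} (h : IsDig a) (n : ℕ) : a n ≤ 2 := by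
  rcases h n with h | h <;> omega

theorem tailSeq_tailSeq_one (a : ℕ → ℕ) (n : ℕ) :
    tailSeq (tailSeq a n) 1 = tailSeq a (n + 1) := by
  funext k
  simp only [tailSeq]
  congr 1
  omega

theorem cfNum_cfDen_succ (a : ℕ → ℕ) (n : ℕ) :
    cfNum a (n + 1) = a 0 * cfNum (tailSeq a 1) n + cfDen (tailSeq a 1) n ∧
      cfDen a (n + 1) = cfNum (tailSeq a 1) n := by
  induction n using Nat.twoStepInduction with
  | zero => simp [cfNum, cfDen, tailSeq, mul_comm]
  | one =>
    simp only [cfNum, cfDen, tailSeq]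
    exact ⟨by ring, trivial⟩
  | more n h1 h2 =>
    have e : tailSeq a 1 (n + 2) = a (n + 3) := by
      simp only [tailSeq]
      congr 1
      omega
    constructor
    · rw [cfNum, h1.1, h2.1, cfNum, cfDen, e]
      ring
    · rw [cfDen, h1.2, h2.2, cfNum, e]

theorem one_le_cfNum {a : ℕ → ℕ} (h : IsDig a) (n : ℕ) : 1 ≤ cfNum a n := by
  induction n using Nat.twoStepInduction with
  | zero => exact h.one_le 0
  | one => simp [cfNum]
  | more n h1 _ =>
    rw [cfNum]
    omega

/-- The convergents. -/
noncomputable def cfConv (a : ℕ → ℕ) (n : ℕ) : ℝ := (cfNum a n : ℝ) / cfDen a n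

theorem cfConv_succ {a : ℕ → ℕ} (h : IsDig a) (n : ℕ) :
    cfConv a (n + 1) = a 0 + 1 / cfConv (tailSeq a 1) n := by
  have h1 : (0 : ℝ) < cfNum (tailSeq a 1) n := by exact_mod_cast one_le_cfNum (h.tailSeq 1) n
  simp only [cfConv]
  rw [(cfNum_cfDen_succ a n).1, (cfNum_cfDen_succ a n).2, one_div_div]
  push_cast
  field_simp

theorem cfConv_mem {a : ℕ → ℕ} (h : IsDig a) (n : ℕ) :
    1 ≤ cfConv a n ∧ cfConv a n ≤ 3 := by
  have b (c : ℕ → ℕ) (hc : IsDig c) : (1 : ℝ) ≤ c 0 ∧ (c 0 : ℝ) ≤ 2 :=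
    ⟨by exact_mod_cast hc.one_le 0, by exact_mod_cast hc.le_two 0⟩
  induction n generalizing a with
  | zero =>
    have := b a h
    simp only [cfConv, cfNum, cfDen, Nat.cast_one, div_one]
    constructor <;> linarith
  | succ n ih =>
    have h1 := ih (h.tailSeq 1)
    have h2 := b a h
    have h3 : 1 / cfConv (tailSeq a 1) n ≤ 1 := (div_le_one (by linarith [h1.1])).2 h1.1
    have h4 : 0 ≤ 1 / cfConv (tailSeq a 1) n := one_div_nonneg.2 (by linarith [h1.1])
    rw [cfConv_succ h]
    constructor <;> linarith

theorem cfConv_succ_ge {a : ℕ → ℕ} (h : IsDig a) (n : ℕ) : 4 / 3 ≤ cfConv a (n + 1) := by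
  have h1 := cfConv_mem (h.tailSeq 1) n
  have h2 : (1 : ℝ) ≤ a 0 := by exact_mod_cast h.one_le 0
  have h3 : 1 / 3 ≤ 1 / cfConv (tailSeq a 1) n :=
    one_div_le_one_div_of_le (by linarith) h1.2
  rw [cfConv_succ h]
  linarith

theorem dist_cfConv_le {a : ℕ → ℕ} (h : IsDig a) (n : ℕ) :
    dist (cfConv a (n + 1)) (cfConv a (n + 1 + 1)) ≤ 2 * (9 / 16) ^ n := by
  rw [Real.dist_eq]
  induction n generalizing a with
  | zero =>
    have h1 := cfConv_mem h 1
    have h2 := cfConv_mem h 2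
    rw [abs_le]
    constructor <;> norm_num <;> linarith
  | succ n ih =>
    have i := ih (h.tailSeq 1)
    have h1 := cfConv_succ_ge (h.tailSeq 1) n
    have h2 := cfConv_succ_ge (h.tailSeq 1) (n + 1)
    rw [cfConv_succ h, cfConv_succ h]
    set x := cfConv (tailSeq a 1) (n + 1)
    set y := cfConv (tailSeq a 1) (n + 1 + 1)
    have hx : 0 < x := by linarith
    have hy : 0 < y := by linarith
    have e : (a 0 : ℝ) + 1 / x - (a 0 + 1 / y) = -(x - y) / (x * y) := by
      field_simp
      ring
    have hxy : 16 / 9 ≤ x * y := by nlinarith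
    rw [e, abs_div, abs_neg, abs_of_pos (mul_pos hx hy), div_le_iff₀ (mul_pos hx hy), pow_succ]
    have : (0 : ℝ) ≤ 2 * (9 / 16) ^ n * (9 / 16) := by positivity
    nlinarith

theorem tendsto_cfConv {a : ℕ → ℕ} (h : IsDig a) :
    Tendsto (cfConv a) atTop (nhds (cfVal a)) := by
  have hc := cauchySeq_of_le_geometric (9 / 16) 2 (by norm_num) (dist_cfConv_le h)
  obtain ⟨l, hl⟩ := cauchySeq_tendsto_of_complete hc
  have hl' : Tendsto (cfConv a) atTop (nhds l) := (tendsto_add_atTop_iff_nat 1).1 hl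
  have : cfVal a = l := hl'.limUnder_eq
  rwa [this]

theorem one_le_cfVal {a : ℕ → ℕ} (h : IsDig a) : 1 ≤ cfVal a :=
  ge_of_tendsto' (tendsto_cfConv h) fun n => (cfConv_mem h n).1

theorem cfVal_eq {a : ℕ → ℕ} (h : IsDig a) : cfVal a = a 0 + cf01 (tailSeq a 1) := by
  have h1 := one_le_cfVal (h.tailSeq 1)
  have h2 := (tendsto_const_nhds (x := (1 : ℝ))).div (tendsto_cfConv (h.tailSeq 1)) (by linarith)
  have h3 := h2.const_add (a 0 : ℝ)
  have h4 := (tendsto_add_atTop_iff_nat 1).2 (tendsto_cfConv h)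
  refine tendsto_nhds_unique h4 (h3.congr fun n => ?_)
  exact (cfConv_succ h n).symm

theorem cf01_eq {a : ℕ → ℕ} (h : IsDig a) : cf01 a = 1 / (a 0 + cf01 (tailSeq a 1)) := by
  rw [cf01, cfVal_eq h]

theorem cf01_pos {a : ℕ → ℕ} (h : IsDig a) : 0 < cf01 a :=
  one_div_pos.2 (by linarith [one_le_cfVal h])

theorem cf01_le_one {a : ℕ → ℕ} (h : IsDig a) : cf01 a ≤ 1 := by
  have := one_le_cfVal h
  exact (div_le_one (by linarith)).2 this

theorem cf01_mem {a : ℕ → ℕ} (h : IsDig a) : 1 / 3 ≤ cf01 a ∧ cf01 a ≤ 3 / 4 := by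
  have key (c : ℕ → ℕ) (hc : IsDig c) : 1 / 3 ≤ cf01 c := by
    have h1 := cf01_le_one (hc.tailSeq 1)
    have h2 := cf01_pos (hc.tailSeq 1)
    have h3 : (c 0 : ℝ) ≤ 2 := by exact_mod_cast hc.le_two 0
    rw [cf01_eq hc]
    exact one_div_le_one_div_of_le (by positivity) (by linarith)
  refine ⟨key a h, ?_⟩
  have h1 := key _ (h.tailSeq 1)
  have h3 : (1 : ℝ) ≤ a 0 := by exact_mod_cast h.one_le 0
  rw [cf01_eq h, div_le_iff₀ (by linarith)]
  linarith

theorem cf01_sub_ge {a b : ℕ → ℕ} (ha : IsDig a) (hb : IsDig b) (h : a 0 ≠ b 0) :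
    1 / 7 ≤ |cf01 a - cf01 b| := by
  wlog hab : a 0 = 1 generalizing a b
  · rw [abs_sub_comm]
    refine this hb ha h.symm ?_
    have := ha 0
    have := hb 0
    omega
  have hb2 : b 0 = 2 := by
    have := hb 0
    omega
  have h1 := cf01_mem (ha.tailSeq 1)
  have h2 := cf01_mem (hb.tailSeq 1)
  have h3 : 4 / 7 ≤ cf01 a := by
    rw [cf01_eq ha, hab, le_div_iff₀ (by norm_num; linarith)]
    norm_num
    linarith
  have h4 : cf01 b ≤ 3 / 7 := by
    rw [cf01_eq hb, hb2, div_le_iff₀ (by norm_num; linarith)]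
    norm_num
    linarith
  refine le_trans ?_ (le_abs_self _)
  linarith

/-- A state of the automaton together with two consecutive continuants `q`, `q'`. -/
structure Config where
  idx : ℕ
  den : ℕ
  prev : ℕ

/-- The transition reading the digit `a`. -/
def Config.step (c : Config) (a : ℕ) : Config :=
  ⟨if a = 1 then (aut c.idx).next1 else (aut c.idx).next2, a * c.den + c.prev, c.den⟩

/-- The configuration before any digit is read. -/
def Config.init : Config := ⟨1, 1, 0⟩

/-- The configuration after reading the first `n` digits of `a`. -/
def Config.run (a : ℕ → ℕ) : ℕ → Config
  | 0 => Config.init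
  | n + 1 => (Config.run a n).step (a n)

theorem abs_cf01_sub_mul {a b : ℕ → ℕ} (ha : IsDig a) (hb : IsDig b) (n : ℕ)
    (h : ∀ k < n, a k = b k) :
    |cf01 a - cf01 b| *
      (((Config.run a n).den + (Config.run a n).prev * cf01 (tailSeq a n)) *
        ((Config.run a n).den + (Config.run a n).prev * cf01 (tailSeq b n))) =
      |cf01 (tailSeq a n) - cf01 (tailSeq b n)| := by
  induction n with
  | zero =>
    have e (c : ℕ → ℕ) : tailSeq c 0 = c := by
      funext k
      simp [tailSeq]
    simp [Config.run, Config.init, e]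
  | succ n ih =>
    have ih := ih fun k hk => h k (by omega)
    have hab : (tailSeq b n) 0 = a n := (h n (by omega)).symm
    have haa : (tailSeq a n) 0 = a n := rfl
    have za := cf01_eq (ha.tailSeq n)
    have zb := cf01_eq (hb.tailSeq n)
    rw [tailSeq_tailSeq_one, haa] at za
    rw [tailSeq_tailSeq_one, hab] at zb
    have pa := cf01_pos (ha.tailSeq (n + 1))
    have pb := cf01_pos (hb.tailSeq (n + 1))
    have pn : (0 : ℝ) < a n := by exact_mod_cast ha.one_le n
    rw [za, zb] at ih
    simp only [Config.run, Config.step]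
    push_cast
    set z := cf01 (tailSeq a (n + 1))
    set w := cf01 (tailSeq b (n + 1))
    set q : ℝ := ((Config.run a n).den : ℝ)
    set p : ℝ := ((Config.run a n).prev : ℝ)
    have hz : 0 < a n + z := by linarith
    have hw : 0 < a n + w := by linarith
    have e1 : 1 / (a n + z) - 1 / (a n + w) = -(z - w) / ((a n + z) * (a n + w)) := by
      field_simp
      ring
    rw [e1, abs_div, abs_neg, abs_of_pos (mul_pos hz hw), eq_div_iff (by positivity)] at ih
    rw [← ih]
    field_simp
    ring

/-- The continuants of a configuration are positive and have a ratio in the interval of the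
state. -/
structure Config.Good (c : Config) : Prop where
  pos : 1 ≤ c.den
  prev_le : c.prev ≤ c.den
  lo : (aut c.idx).lo * c.den ≤ 1000000 * c.prev
  hi : 1000000 * c.prev ≤ (aut c.idx).hi * c.den

theorem aut_arith (i : ℕ) :
    (aut i).arith (aut (aut i).next1) (aut (aut i).next2) = true ∧ (aut i).small = true := by
  have h := automaton_arith
  rw [List.all_eq_true] at h
  rcases lt_or_ge i automaton.length with hi | hi
  · have := h (aut i) (by
      rw [aut, List.getD_eq_getElem _ _ hi]
      exact List.getElem_mem hi)
    simpa using this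
  · have := h (aut 0) (List.mem_of_getElem (i := 0) (h := by decide +kernel) rfl)
    have e : aut i = aut 0 := by
      rw [aut, List.getD_eq_default _ _ hi]
      rfl
    rw [e]
    simpa using this

/-- The approximate eigenfunction. -/
noncomputable def Config.val (c : Config) : ℝ :=
  (aut c.idx).weight / ((aut c.idx).form c.den c.prev : ℕ)

theorem leCoeff_iff {k l : ℕ} {p q : ℕ × ℕ × ℕ} :
    leCoeff k p l q = true ↔
      k * p.1 ≤ l * q.1 ∧ k * p.2.1 ≤ l * q.2.1 ∧ k * p.2.2 ≤ l * q.2.2 := by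
  simp [leCoeff, and_assoc]

theorem aut_next (i a : ℕ) (ha : a = 1 ∨ a = 2) :
    let v := aut (if a = 1 then (aut i).next1 else (aut i).next2)
    v.lo * (a * 1000000 + (aut i).hi) ≤ 1000000 * 1000000 ∧
      1000000 * 1000000 ≤ v.hi * (a * 1000000 + (aut i).lo) := by
  have h := (aut_arith i).1
  simp only [AutState.arith, AutState.mapsTo, Bool.and_eq_true, Nat.ble_eq] at h
  rcases ha with rfl | rfl
  · exact h.1.1.1.2
  · exact h.1.1.2

theorem Config.Good.step {c : Config} (h : c.Good) {a : ℕ} (ha : a = 1 ∨ a = 2) :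
    (c.step a).Good := by
  have h1 := aut_next c.idx a ha
  have hp := h.pos
  have ha1 : 1 ≤ a := by omega
  refine ⟨?_, ?_, ?_, ?_⟩
  · simp only [Config.step]
    nlinarith
  · simp only [Config.step]
    nlinarith
  · simp only [Config.step]
    have := Nat.mul_le_mul_right c.den h1.1
    have h2 := Nat.mul_le_mul_left
      (aut (if a = 1 then (aut c.idx).next1 else (aut c.idx).next2)).lo h.hi
    nlinarith
  · simp only [Config.step]
    have := Nat.mul_le_mul_right c.den h1.2
    have h2 := Nat.mul_le_mul_left
      (aut (if a = 1 then (aut c.idx).next1 else (aut c.idx).next2)).hi h.lo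
    nlinarith

theorem Config.init_good : Config.init.Good :=
  ⟨by decide, by decide, by decide +kernel, by decide +kernel⟩

theorem eval_mul_le {k l : ℕ} {P Q R S : ℕ × ℕ}
    (h : leCoeff k (mulCoeff P Q) l (mulCoeff R S) = true) {u v : ℝ} (hu : 0 ≤ u) (hv : 0 ≤ v) :
    k * ((u * P.1 + v * P.2) * (u * Q.1 + v * Q.2)) ≤
      l * ((u * R.1 + v * R.2) * (u * S.1 + v * S.2)) := by
  obtain ⟨h1, h2, h3⟩ := leCoeff_iff.1 h
  simp only [mulCoeff] at h1 h2 h3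
  rify at h1 h2 h3
  have a1 := mul_le_mul_of_nonneg_left h1 (mul_nonneg hu hu)
  have a2 := mul_le_mul_of_nonneg_left h2 (mul_nonneg hu hv)
  have a3 := mul_le_mul_of_nonneg_left h3 (mul_nonneg hv hv)
  linarith

theorem aut_slope_pos (i : ℕ) : 0 < (aut i).slope := by
  have h := (aut_arith i).1
  simp only [AutState.arith, Bool.and_eq_true, Nat.blt_eq] at h
  exact h.1.1.1.1.2

theorem Config.Good.form_pos {c : Config} (h : c.Good) :
    (0 : ℝ) < ((aut c.idx).form c.den c.prev : ℕ) := by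
  have h1 := Nat.mul_pos (aut_slope_pos c.idx) h.pos
  rw [AutState.form]
  exact_mod_cast by omega

theorem Config.Good.val_le {c : Config} (h : c.Good) :
    (1 + 25 / 1000000) * c.val ≤ (c.step 1).val + (c.step 2).val ∧
      (c.step 1).val + (c.step 2).val ≤ (1 + 30 / 1000000) * c.val := by
  have harith := (aut_arith c.idx).1
  simp only [AutState.arith, Bool.and_eq_true, Nat.blt_eq] at harith
  obtain ⟨⟨⟨⟨⟨hD, -⟩, -⟩, -⟩, hup⟩, hlow⟩ := harith
  have pK := h.form_pos
  have pL := (h.step (a := 1) (Or.inl rfl)).form_pos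
  have pR := (h.step (a := 2) (Or.inr rfl)).form_pos
  have hlo := h.lo
  have hhi := h.hi
  simp only [Config.val]
  simp only [Config.step, AutState.form, AutState.child, if_true, one_mul,
    show (2 : ℕ) ≠ 1 by decide, if_false] at *
  set A := aut c.idx
  set B := aut A.next1
  set C := aut A.next2
  set q := c.den
  set p := c.prev
  have hu : (0 : ℝ) ≤ A.hi * q - 1000000 * p := by rify at hhi; linarith
  have hv : (0 : ℝ) ≤ 1000000 * p - A.lo * q := by rify at hlo; linarith
  have hup := eval_mul_le hup hu hv
  have hlow := eval_mul_le hlow hu hv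
  push_cast at *
  have hD : (0 : ℝ) < (A.hi - A.lo) * 1000000 := by rify at hD; nlinarith
  set D : ℝ := (A.hi - A.lo) * 1000000 with hDdef
  set u : ℝ := A.hi * q - 1000000 * p with hudef
  set v : ℝ := 1000000 * p - A.lo * q with hvdef
  set K : ℝ := A.slope * q + 10000 * p with hK
  set L : ℝ := B.slope * (q + p) + 10000 * q with hL
  set R : ℝ := C.slope * (2 * q + p) + 10000 * q with hR
  have eL : u * (B.slope * (1000000 + A.lo) + 10000000000) +
      v * (B.slope * (1000000 + A.hi) + 10000000000) = D * L := by
    rw [hudef, hvdef, hDdef, hL]; ring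
  have eR : u * (C.slope * (2000000 + A.lo) + 10000000000) +
      v * (C.slope * (2000000 + A.hi) + 10000000000) = D * R := by
    rw [hudef, hvdef, hDdef, hR]; ring
  have eK : u * (A.slope * 1000000 + 10000 * A.lo) +
      v * (A.slope * 1000000 + 10000 * A.hi) = D * K := by
    rw [hudef, hvdef, hDdef, hK]; ring
  have eS : u * (B.weight * (C.slope * (2000000 + A.lo) + 10000000000) +
        C.weight * (B.slope * (1000000 + A.lo) + 10000000000)) +
      v * (B.weight * (C.slope * (2000000 + A.hi) + 10000000000) +
        C.weight * (B.slope * (1000000 + A.hi) + 10000000000)) =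
      D * (B.weight * R + C.weight * L) := by
    linear_combination (B.weight : ℝ) * eR + (C.weight : ℝ) * eL
  rw [eL, eR, eK, eS] at hup hlow
  have hDD : 0 < D * D := mul_pos hD hD
  rw [div_add_div _ _ pL.ne' pR.ne', ← mul_div_assoc, ← mul_div_assoc,
    div_le_div_iff₀ pK (mul_pos pL pR), div_le_div_iff₀ (mul_pos pL pR) pK]
  constructor
  · refine le_of_mul_le_mul_left ?_ hDD
    linarith
  · refine le_of_mul_le_mul_left ?_ hDD
    linarith

theorem Config.val_nonneg (c : Config) : 0 ≤ c.val := by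
  rw [Config.val]
  positivity

theorem Config.Good.inv_le_val {c : Config} (h : c.Good) (hw : (aut c.idx).weight ≠ 0) :
    1 / (c.den : ℝ) ≤ 1010000 * c.val := by
  have hs := (aut_arith c.idx).2
  simp only [AutState.small, Bool.and_eq_true, Nat.ble_eq] at hs
  have hK := h.form_pos
  have hq : (0 : ℝ) < c.den := by exact_mod_cast h.pos
  have h1 : (1 : ℝ) ≤ (aut c.idx).weight := by exact_mod_cast Nat.one_le_iff_ne_zero.2 hw
  have h2 : (aut c.idx).form c.den c.prev ≤ 1010000 * c.den := by
    have := Nat.mul_le_mul_right c.den hs.2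
    have := h.prev_le
    rw [AutState.form]
    omega
  rify at h2
  rw [Config.val, ← mul_div_assoc, div_le_div_iff₀ hq hK]
  nlinarith

theorem Config.Good.val_le_inv {c : Config} (h : c.Good) :
    c.val ≤ 1000000000 * (1 / (c.den : ℝ)) := by
  have hs := (aut_arith c.idx).2
  simp only [AutState.small, Bool.and_eq_true, Nat.ble_eq] at hs
  have hK := h.form_pos
  have hq : (0 : ℝ) < c.den := by exact_mod_cast h.pos
  have h1 : ((aut c.idx).weight : ℝ) ≤ 1000000000 := by exact_mod_cast hs.1
  have h2 : c.den ≤ (aut c.idx).form c.den c.prev := by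
    have := Nat.mul_le_mul_right c.den (aut_slope_pos c.idx)
    rw [AutState.form]
    omega
  rify at h2
  rw [Config.val, mul_one_div, div_le_div_iff₀ hK hq]
  exact mul_le_mul h1 h2 hq.le (by norm_num)

theorem Config.run_good {a : ℕ → ℕ} (ha : IsDig a) (n : ℕ) : (Config.run a n).Good := by
  induction n with
  | zero => exact Config.init_good
  | succ n ih => exact ih.step (ha n)

theorem Config.run_den_le {a : ℕ → ℕ} (ha : IsDig a) (n : ℕ) : (Config.run a n).den ≤ 3 ^ n := by
  induction n with
  | zero => exact le_rfl
  | succ n ih =>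
    have h1 := (Config.run_good ha n).prev_le
    have h2 := Nat.mul_le_mul_right (Config.run a n).den (ha.le_two n)
    simp only [Config.run, Config.step, pow_succ]
    omega

theorem Config.two_pow_le_run {a : ℕ → ℕ} (ha : IsDig a) (n : ℕ) :
    2 ^ n ≤ 2 * (Config.run a n).den ^ 2 := by
  have key : 2 ^ n ≤ (Config.run a n).den * ((Config.run a n).den + (Config.run a n).prev) := by
    induction n with
    | zero => exact le_rfl
    | succ n ih =>
      have h2 := Nat.mul_le_mul_right (Config.run a n).den (ha.one_le n)
      simp only [Config.run, Config.step, pow_succ]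
      nlinarith
  have := (Config.run_good ha n).prev_le
  nlinarith

theorem abs_cf01_sub_le {a b : ℕ → ℕ} (ha : IsDig a) (hb : IsDig b) (n : ℕ)
    (h : ∀ k < n, a k = b k) :
    |cf01 a - cf01 b| ≤ 1 / ((Config.run a n).den : ℝ) ^ 2 := by
  have e := abs_cf01_sub_mul ha hb n h
  have ma := cf01_mem (ha.tailSeq n)
  have mb := cf01_mem (hb.tailSeq n)
  have hq : (0 : ℝ) < (Config.run a n).den := by exact_mod_cast (Config.run_good ha n).pos
  have hp : (0 : ℝ) ≤ (Config.run a n).prev := by positivity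
  rw [le_div_iff₀ (by positivity)]
  have h1 : |cf01 (tailSeq a n) - cf01 (tailSeq b n)| ≤ 1 := by
    rw [abs_le]
    constructor <;> linarith
  rw [← e] at h1
  refine le_trans (mul_le_mul_of_nonneg_left ?_ (abs_nonneg _)) h1
  rw [pow_two]
  have x1 := mul_nonneg hp (by linarith : 0 ≤ cf01 (tailSeq a n))
  have x2 := mul_nonneg hp (by linarith : 0 ≤ cf01 (tailSeq b n))
  exact mul_le_mul (by linarith) (by linarith) hq.le (by linarith)

theorem le_abs_cf01_sub {a b : ℕ → ℕ} (ha : IsDig a) (hb : IsDig b) (n : ℕ)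
    (h : ∀ k < n, a k = b k) (hn : a n ≠ b n) :
    1 / (28 * ((Config.run a n).den : ℝ) ^ 2) ≤ |cf01 a - cf01 b| := by
  have e := abs_cf01_sub_mul ha hb n h
  have ma := cf01_mem (ha.tailSeq n)
  have mb := cf01_mem (hb.tailSeq n)
  have hq : (0 : ℝ) < (Config.run a n).den := by exact_mod_cast (Config.run_good ha n).pos
  have hp : (0 : ℝ) ≤ (Config.run a n).prev := by positivity
  have hpq : ((Config.run a n).prev : ℝ) ≤ (Config.run a n).den := by
    exact_mod_cast (Config.run_good ha n).prev_le
  have h1 := cf01_sub_ge (ha.tailSeq n) (hb.tailSeq n) (by simpa [tailSeq] using hn)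
  rw [← e] at h1
  rw [div_le_iff₀ (by positivity)]
  have h2 : (((Config.run a n).den : ℝ) + (Config.run a n).prev * cf01 (tailSeq a n)) *
      ((Config.run a n).den + (Config.run a n).prev * cf01 (tailSeq b n)) ≤
      4 * ((Config.run a n).den : ℝ) ^ 2 := by
    have x1 : (Config.run a n).prev * cf01 (tailSeq a n) ≤ (Config.run a n).den := by nlinarith
    have x2 : (Config.run a n).prev * cf01 (tailSeq b n) ≤ (Config.run a n).den := by nlinarith
    have y2 := mul_nonneg hp (by linarith : 0 ≤ cf01 (tailSeq b n))
    calc _ ≤ (2 * ((Config.run a n).den : ℝ)) * (2 * (Config.run a n).den) :=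
          mul_le_mul (by linarith) (by linarith) (by linarith) (by linarith)
      _ = _ := by ring
  have := mul_le_mul_of_nonneg_left h2 (abs_nonneg (cf01 a - cf01 b))
  linarith

theorem isPre_iff {l m : List ℕ} : isPre l m = true ↔ l <+: m := by
  induction l generalizing m with
  | nil => simp [isPre]
  | cons a l ih =>
    cases m with
    | nil => simp [isPre]
    | cons b m => simp [isPre, List.cons_prefix_cons, ih, Bool.cond_eq_ite]

theorem aut_words (i : ℕ) : (aut i).words forbiddenSym forbiddenTails = true := by
  have h := automaton_words
  rw [List.all_eq_true] at h
  rcases lt_or_ge i automaton.length with hi | hi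
  · refine h (aut i) ?_
    rw [aut, List.getD_eq_getElem _ _ hi]
    exact List.getElem_mem hi
  · rw [aut, List.getD_eq_default _ _ hi, AutState.words]
    rfl

/-- The state is not the dead state. -/
def Config.Alive (c : Config) : Prop := (aut c.idx).weight ≠ 0

theorem AutState.trans_spec {c v : AutState} {a : ℕ} {F T : List (List ℕ)}
    (h : c.trans v a F T = true) :
    (v.weight = 0 → ∃ f ∈ F, f <+: a :: c.label) ∧
      (v.weight ≠ 0 → v.label <+: a :: c.label ∧
        ∀ p ∈ T, p <+: a :: c.label → p <+: v.label) := by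
  obtain ⟨u, _, _, _, _, _, _⟩ := c
  obtain ⟨v, _, _, _, _, k, _⟩ := v
  rw [AutState.trans, Bool.cond_eq_ite] at h
  constructor
  · intro hk
    simp only at hk
    subst hk
    simpa [isPre_iff] using h
  · intro hk
    simp only at hk ⊢
    rw [if_neg (by simpa using hk), Bool.and_eq_true, Bool.or_eq_true, isPre_iff, isPre_iff,
      List.all_eq_true] at h
    refine ⟨h.1, fun p hp hpu => ?_⟩
    rcases h.2 with h2 | h2
    · exact hpu.trans h2
    · have := h2 p hp
      rwa [isPre_iff.2 hpu, cond_true, isPre_iff] at this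

theorem Config.Alive.not_forbidden {c : Config} (h : c.Alive) {f : List ℕ} (hf : f ∈ forbiddenSym) :
    ¬ f <+: (aut c.idx).label := by
  have hw := aut_words c.idx
  rw [AutState.words, Bool.cond_eq_ite, if_neg (by simpa [Config.Alive] using h)] at hw
  simp only [Bool.and_eq_true, List.all_eq_true] at hw
  rw [← isPre_iff]
  simpa using hw.1.1 f hf

theorem Config.Alive.trans_step {c : Config} (h : c.Alive) {a : ℕ} (ha : a = 1 ∨ a = 2) :
    (aut c.idx).trans (aut (c.step a).idx) a forbiddenSym forbiddenTails = true := by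
  have hw := aut_words c.idx
  rw [AutState.words, Bool.cond_eq_ite, if_neg (by simpa [Config.Alive] using h)] at hw
  simp only [Bool.and_eq_true] at hw
  rcases ha with rfl | rfl
  · exact hw.1.2
  · exact hw.2

theorem Config.init_alive : Config.init.Alive := by
  rw [Config.Alive]
  decide +kernel

/-- The first `n` digits of `a`, latest first. -/
def hist (a : ℕ → ℕ) : ℕ → List ℕ
  | 0 => []
  | n + 1 => a n :: hist a n

theorem length_hist (a : ℕ → ℕ) (n : ℕ) : (hist a n).length = n := by
  induction n with
  | zero => rfl
  | succ n ih => simp [hist, ih]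

theorem occursAtN_append_singleton (a : ℕ → ℕ) (i : ℕ) (w : List ℕ) (x : ℕ) :
    occursAtN a i (w ++ [x]) ↔ a (i + w.length) = x ∧ occursAtN a i w := by
  constructor
  · intro h
    refine ⟨by simpa using h w.length (by simp), fun j hj => ?_⟩
    rw [h j (by simp; omega), List.getD_append _ _ _ _ hj]
  · rintro ⟨h1, h2⟩ j hj
    rcases Nat.lt_or_ge j w.length with hj' | hj'
    · rw [h2 j hj', List.getD_append _ _ _ _ hj']
    · have : j = w.length := by
        simp at hj
        omega
      subst this
      simp [h1]

theorem occursAtN_iff (a : ℕ → ℕ) (i : ℕ) (w : List ℕ) :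
    occursAtN a i w ↔ w.reverse <+: hist a (i + w.length) := by
  induction w using List.reverseRecOn with
  | nil => simp [occursAtN]
  | append_singleton w x ih =>
    rw [occursAtN_append_singleton, ih, List.reverse_append, List.length_append,
      List.length_singleton, ← add_assoc, hist, List.reverse_singleton, List.singleton_append,
      List.cons_prefix_cons, eq_comm]

/-- No forbidden word occurs in `a`. -/
def Admissible (a : ℕ → ℕ) : Prop := ∀ f ∈ forbiddenSym, ∀ n, ¬ f <+: hist a n

theorem admissible_iff (a : ℕ → ℕ) :
    Admissible a ↔
      ∀ w ∈ forbiddenB1, ∀ i, ¬ occursAtN a i w ∧ ¬ occursAtN a i w.reverse := by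
  simp only [occursAtN_iff, List.reverse_reverse, List.length_reverse]
  constructor
  · intro h w hw i
    refine ⟨h _ ?_ _, h _ ?_ _⟩
    · exact List.mem_append_right _ (List.mem_map_of_mem hw)
    · exact List.mem_append_left _ hw
  · intro h f hf n hfn
    have hl := hfn.length_le
    rw [length_hist] at hl
    rcases List.mem_append.1 hf with hf | hf
    · refine (h f hf (n - f.length)).2 ?_
      rwa [Nat.sub_add_cancel hl]
    · obtain ⟨w, hw, rfl⟩ := List.mem_map.1 hf
      refine (h w hw (n - w.length)).1 ?_
      rw [List.length_reverse] at hl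
      rwa [Nat.sub_add_cancel hl]

theorem Admissible.alive {a : ℕ → ℕ} (h : Admissible a) (ha : IsDig a) (n : ℕ) :
    (Config.run a n).Alive := by
  suffices key : (Config.run a n).Alive ∧ (aut (Config.run a n).idx).label <+: hist a n from key.1
  induction n with
  | zero =>
    have e : (aut 1).label = [] := by decide +kernel
    exact ⟨Config.init_alive, by simp [Config.run, Config.init, e]⟩
  | succ n ih =>
    have ht := AutState.trans_spec (ih.1.trans_step (ha n))
    have hp : a n :: (aut (Config.run a n).idx).label <+: hist a (n + 1) :=
      List.cons_prefix_cons.2 ⟨rfl, ih.2⟩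
    have hal : (Config.run a (n + 1)).Alive := by
      intro h0
      obtain ⟨f, hf, hfp⟩ := ht.1 h0
      exact h f hf _ (hfp.trans hp)
    exact ⟨hal, (ht.2 hal).1.trans hp⟩

theorem mem_forbiddenTails {p : List ℕ} : p ∈ forbiddenTails ↔ ∃ f ∈ forbiddenSym, p <:+ f := by
  simp [forbiddenTails, List.mem_flatMap]

theorem admissible_of_alive {a : ℕ → ℕ} (ha : IsDig a) (h : ∀ n, (Config.run a n).Alive) :
    Admissible a := by
  have key (n : ℕ) : ∀ p ∈ forbiddenTails, p <+: hist a n →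
      p <+: (aut (Config.run a n).idx).label := by
    induction n with
    | zero =>
      intro p _ hp
      rw [List.prefix_nil.1 hp]
      simp
    | succ n ih =>
      intro p hp hpn
      refine ((AutState.trans_spec ((h n).trans_step (ha n))).2 (h (n + 1))).2 p hp ?_
      cases p with
      | nil => simp
      | cons b p =>
        rw [hist, List.cons_prefix_cons] at hpn
        obtain ⟨f, hf, hpf⟩ := mem_forbiddenTails.1 hp
        have := ih p (mem_forbiddenTails.2 ⟨f, hf, (List.suffix_cons b p).trans hpf⟩) hpn.2
        exact List.cons_prefix_cons.2 ⟨hpn.1, this⟩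
  intro f hf n hfn
  exact (h n).not_forbidden hf (key n f (mem_forbiddenTails.2 ⟨f, hf, List.suffix_rfl⟩) hfn)

theorem mem_gaussCantorRev_iff {x : ℝ} :
    x ∈ gaussCantorRev {1, 2} forbiddenB1 ↔ ∃ a, IsDig a ∧ Admissible a ∧ x = cf01 a := by
  simp only [admissible_iff]
  rfl

/-- The digit encoded by a Boolean. -/
def digit (b : Bool) : ℕ := bif b then 2 else 1

theorem digit_mem (b : Bool) : digit b = 1 ∨ digit b = 2 := by
  cases b <;> simp [digit]

/-- The configuration after reading a finite word. -/
def Config.ofWord : (n : ℕ) → (Fin n → Bool) → Config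
  | 0, _ => Config.init
  | n + 1, w => (Config.ofWord n fun i => w i.castSucc).step (digit (w (Fin.last n)))

theorem Config.ofWord_good (n : ℕ) (w : Fin n → Bool) : (Config.ofWord n w).Good := by
  induction n with
  | zero => exact Config.init_good
  | succ n ih => exact (ih _).step (digit_mem _)

theorem Config.ofWord_eq_run {a : ℕ → ℕ} {n : ℕ} {w : Fin n → Bool}
    (h : ∀ i : Fin n, a i = digit (w i)) : Config.ofWord n w = Config.run a n := by
  induction n with
  | zero => rfl
  | succ n ih =>
    rw [Config.ofWord, Config.run, ih fun i => h i.castSucc, ← h (Fin.last n), Fin.val_last]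

theorem Config.sum_val_le (n : ℕ) :
    ∑ w : Fin n → Bool, (Config.ofWord n w).val ≤
      (1 + 30 / 1000000) ^ n * Config.init.val := by
  induction n with
  | zero => simp [Config.ofWord]
  | succ n ih =>
    rw [← (Fin.snocEquiv fun _ => Bool).sum_comp, Fintype.sum_prod_type_right]
    have e (w : Fin n → Bool) : ∑ b : Bool, (Config.ofWord (n + 1)
        (Fin.snocEquiv (fun _ => Bool) (b, w))).val ≤
        (1 + 30 / 1000000) * (Config.ofWord n w).val := by
      have := (Config.ofWord_good n w).val_le.2
      simpa [Config.ofWord, Fin.snocEquiv, digit, add_comm] using this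
    refine (Finset.sum_le_sum fun w _ => e w).trans ?_
    rw [← Finset.mul_sum, pow_succ']
    linarith

theorem one_add_pow_le_two {x : ℝ} (hx : 0 ≤ x) (N : ℕ) (h : N * x ≤ 0.69) :
    (1 + x) ^ N ≤ 2 := by
  have e1 : 1 + x ≤ Real.exp x := by
    linarith [Real.add_one_le_exp x]
  have e2 : Real.exp (N * x) ≤ 2 := by
    rw [← Real.le_log_iff_exp_le (by norm_num)]
    have := Real.log_two_gt_d9
    norm_num at h
    linarith
  rw [Real.exp_nat_mul] at e2
  exact (pow_le_pow_left₀ (by linarith) e1 _).trans e2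

theorem inv_sq_rpow_le {q t : ℝ} {N n : ℕ} (hN : N ≠ 0) (ht : 0 < t) (hNt : t ^ N ≤ 2)
    (hq : 0 < q) (h : 2 ^ n ≤ 2 * q ^ 2) :
    (1 / q ^ 2) ^ (1 / 2 + 1 / (N : ℝ)) ≤ 2 * (t ^ n)⁻¹ * (1 / q) := by
  have hN1 : (1 : ℝ) ≤ N := by exact_mod_cast Nat.one_le_iff_ne_zero.2 hN
  have hN2 : 1 / (N : ℝ) ≤ 1 := (div_le_one (by linarith)).2 hN1
  have hy : 1 / q ^ 2 ≤ 2 * (1 / 2) ^ n := by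
    rw [one_div_pow, mul_one_div, div_le_div_iff₀ (by positivity) (by positivity)]
    linarith
  have h1 : (1 / q ^ 2) ^ (1 / 2 : ℝ) = 1 / q := by
    rw [← Real.sqrt_eq_rpow, ← one_div_pow, Real.sqrt_sq (by positivity)]
  have h2 : (1 / 2 : ℝ) ^ (1 / N : ℝ) ≤ t⁻¹ := by
    have e : (1 / 2 : ℝ) ≤ t⁻¹ ^ N := by
      rw [inv_pow, one_div]
      exact inv_anti₀ (by positivity) hNt
    refine (Real.rpow_le_rpow (by norm_num) e (by positivity)).trans_eq ?_
    rw [one_div, Real.pow_rpow_inv_natCast (by positivity) hN]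
  have h3 : (1 / q ^ 2) ^ (1 / N : ℝ) ≤ 2 * (t ^ n)⁻¹ := by
    refine (Real.rpow_le_rpow (by positivity) hy (by positivity)).trans ?_
    rw [Real.mul_rpow (by norm_num) (by positivity), ← Real.rpow_natCast, ← Real.rpow_mul
      (by norm_num), mul_comm (n : ℝ), Real.rpow_mul (by norm_num), Real.rpow_natCast, ← inv_pow]
    refine mul_le_mul ?_ (pow_le_pow_left₀ (by positivity) h2 n) (by positivity) (by norm_num)
    exact (Real.rpow_le_rpow_of_exponent_le (by norm_num) hN2).trans_eq (Real.rpow_one 2)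
  rw [Real.rpow_add (by positivity), h1, mul_comm]
  exact mul_le_mul_of_nonneg_right h3 (by positivity)

/-- The points of the Cantor set with a given finite prefix. -/
def cylinder (n : ℕ) (w : Fin n → Bool) : Set ℝ :=
  {x | ∃ a, IsDig a ∧ Admissible a ∧ (∀ i : Fin n, a i = digit (w i)) ∧ x = cf01 a}

theorem ediam_cylinder_le {a : ℕ → ℕ} {n : ℕ} {w : Fin n → Bool}
    (h : ∀ i : Fin n, a i = digit (w i)) :
    Metric.ediam (cylinder n w) ≤ ENNReal.ofReal (1 / ((Config.run a n).den : ℝ) ^ 2) := by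
  refine Metric.ediam_le ?_
  rintro _ ⟨b, hb, -, hbw, rfl⟩ _ ⟨c, hc, -, hcw, rfl⟩
  rw [edist_dist, Real.dist_eq, ← Config.ofWord_eq_run h, Config.ofWord_eq_run hbw]
  refine ENNReal.ofReal_le_ofReal (abs_cf01_sub_le hb hc n fun k hk => ?_)
  rw [hbw ⟨k, hk⟩, hcw ⟨k, hk⟩]

theorem ediam_cylinder_le_pow (n : ℕ) (w : Fin n → Bool) :
    Metric.ediam (cylinder n w) ≤ ENNReal.ofReal (2 * (1 / 2) ^ n) := by
  rcases (cylinder n w).eq_empty_or_nonempty with h | ⟨_, a, ha, -, haw, rfl⟩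
  · simp [h]
  · refine (ediam_cylinder_le haw).trans (ENNReal.ofReal_le_ofReal ?_)
    have hq : (0 : ℝ) < (Config.run a n).den := by exact_mod_cast (Config.run_good ha n).pos
    have h2 : (2 : ℝ) ^ n ≤ 2 * ((Config.run a n).den : ℝ) ^ 2 := by
      exact_mod_cast Config.two_pow_le_run ha n
    rw [one_div_pow, mul_one_div, div_le_div_iff₀ (by positivity) (by positivity)]
    linarith

theorem ediam_cylinder_rpow_le (n : ℕ) (w : Fin n → Bool) :
    Metric.ediam (cylinder n w) ^ (1 / 2 + 1 / 22000 : ℝ) ≤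
      ENNReal.ofReal (2020000 * ((1 + 30 / 1000000) ^ n)⁻¹ * (Config.ofWord n w).val) := by
  rcases (cylinder n w).eq_empty_or_nonempty with h | ⟨_, a, ha, had, haw, rfl⟩
  · rw [h, Metric.ediam_empty, ENNReal.zero_rpow_of_pos (by norm_num)]
    exact zero_le
  · refine (ENNReal.rpow_le_rpow (ediam_cylinder_le haw) (by norm_num)).trans ?_
    have hq : (0 : ℝ) < (Config.run a n).den := by exact_mod_cast (Config.run_good ha n).pos
    rw [ENNReal.ofReal_rpow_of_pos (by positivity)]
    have hb := inv_sq_rpow_le (n := n) (N := 22000) (by norm_num) (by norm_num)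
      (one_add_pow_le_two (x := 30 / 1000000) (by norm_num) 22000 (by norm_num)) hq
      (by exact_mod_cast Config.two_pow_le_run ha n)
    rw [Nat.cast_ofNat] at hb
    refine ENNReal.ofReal_le_ofReal (hb.trans ?_)
    rw [Config.ofWord_eq_run haw]
    have h1 := (Config.run_good ha n).inv_le_val (had.alive ha n)
    have h2 := mul_le_mul_of_nonneg_left h1
      (by positivity : (0 : ℝ) ≤ 2 * ((1 + 30 / 1000000) ^ n)⁻¹)
    linarith

theorem dimH_le_of_automaton :
    dimH (gaussCantorRev {1, 2} forbiddenB1) ≤ ENNReal.ofReal (1 / 2 + 1 / 22000) := by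
  refine dimH_le_of_hausdorffMeasure_ne_top ?_
  have h := MeasureTheory.Measure.hausdorffMeasure_le_liminf_sum (1 / 2 + 1 / 22000)
    (gaussCantorRev {1, 2} forbiddenB1) (l := atTop)
    (fun n => ENNReal.ofReal (2 * (1 / 2) ^ n)) ?_ cylinder
    (Eventually.of_forall ediam_cylinder_le_pow) (Eventually.of_forall fun n x hx => ?_)
  · have hs : ((1 / 2 + 1 / 22000 : ℝ).toNNReal : ℝ) = 1 / 2 + 1 / 22000 :=
      Real.coe_toNNReal _ (by norm_num)
    rw [hs]
    refine ne_top_of_le_ne_top (b := ENNReal.ofReal (2020000 * Config.init.val))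
      ENNReal.ofReal_ne_top (h.trans ?_)
    refine (liminf_le_liminf (Eventually.of_forall fun n => ?_)).trans_eq
      (liminf_const (f := atTop (α := ℕ)) _)
    refine (Finset.sum_le_sum fun w _ => ediam_cylinder_rpow_le n w).trans ?_
    rw [← ENNReal.ofReal_sum_of_nonneg fun w _ => by
      have := (Config.ofWord n w).val_nonneg
      positivity, ← Finset.mul_sum]
    refine ENNReal.ofReal_le_ofReal ?_
    refine (mul_le_mul_of_nonneg_left (Config.sum_val_le n) (by positivity)).trans_eq ?_
    field_simp
  · have h1 : Tendsto (fun n : ℕ => 2 * (1 / 2 : ℝ) ^ n) atTop (nhds (2 * 0)) :=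
      (tendsto_pow_atTop_nhds_zero_of_lt_one (by norm_num) (by norm_num)).const_mul 2
    simpa using ENNReal.tendsto_ofReal h1
  · obtain ⟨a, ha, had, rfl⟩ := mem_gaussCantorRev_iff.1 hx
    refine Set.mem_iUnion.2 ⟨fun i => decide (a i = 2), a, ha, had, fun i => ?_, rfl⟩
    rcases ha i with h | h <;> simp [h, digit]

/-- The proportion of the mass of `c` that is given to the digit `1`. -/
noncomputable def Config.split (c : Config) : ℝ :=
  (c.step 1).val / ((c.step 1).val + (c.step 2).val)

/-- The nested partitions of `[0, 1)` in which the interval of a configuration is divided in the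
proportion `Config.split`: the configuration, the left end and the length of the interval of the
`n`-th partition containing `y`. -/
noncomputable def coding (y : ℝ) : ℕ → Config × ℝ × ℝ
  | 0 => (Config.init, 0, 1)
  | n + 1 =>
    let p := coding y n
    if y < p.2.1 + p.2.2 * p.1.split then (p.1.step 1, p.2.1, p.2.2 * p.1.split)
    else (p.1.step 2, p.2.1 + p.2.2 * p.1.split, p.2.2 * (1 - p.1.split))

/-- The digit sequence that encodes the position of `y` in the nested partitions. -/
noncomputable def digitSeq (y : ℝ) (n : ℕ) : ℕ :=
  if y < (coding y n).2.1 + (coding y n).2.2 * (coding y n).1.split then 1 else 2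

theorem isDig_digitSeq (y : ℝ) : IsDig (digitSeq y) := by
  intro n
  rw [digitSeq]
  split_ifs <;> simp

theorem run_digitSeq (y : ℝ) (n : ℕ) : Config.run (digitSeq y) n = (coding y n).1 := by
  induction n with
  | zero => rfl
  | succ n ih =>
    rw [Config.run, ih, digitSeq, coding]
    split_ifs <;> rfl

theorem coding_congr {y z : ℝ} {n : ℕ} (h : ∀ k < n, digitSeq y k = digitSeq z k) :
    coding y n = coding z n := by
  induction n with
  | zero => rfl
  | succ n ih =>
    have ih := ih fun k hk => h k (by omega)
    have hn := h n (by omega)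
    simp only [digitSeq, ih] at hn
    simp only [coding, ih]
    split_ifs at hn ⊢ <;> first | rfl | simp at hn

theorem Config.init_val_pos : 0 < Config.init.val := by
  have h := Config.init_good.form_pos
  have h1 : (0 : ℝ) < (aut Config.init.idx).weight :=
    Nat.cast_pos.2 (Nat.pos_of_ne_zero Config.init_alive)
  exact div_pos h1 h

theorem coding_spec {y : ℝ} (h0 : 0 ≤ y) (h1 : y < 1) (n : ℕ) :
    0 < (coding y n).1.val ∧ (coding y n).2.1 ≤ y ∧ y < (coding y n).2.1 + (coding y n).2.2 ∧
      (coding y n).2.2 * (Config.init.val * (1 + 25 / 1000000) ^ n) ≤ (coding y n).1.val := by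
  induction n with
  | zero => exact ⟨Config.init_val_pos, h0, by simpa [coding] using h1, by simp [coding]⟩
  | succ n ih =>
    obtain ⟨hv, hl, hr, hm⟩ := ih
    have hgood := Config.run_good (isDig_digitSeq y) n
    rw [run_digitSeq] at hgood
    have hval := hgood.val_le.1
    have n1 := ((coding y n).1.step 1).val_nonneg
    have n2 := ((coding y n).1.step 2).val_nonneg
    rw [coding]
    set c := (coding y n).1
    set l := (coding y n).2.1
    set m := (coding y n).2.2
    set v := (c.step 1).val
    set w := (c.step 2).val
    have hvw : 0 < v + w := by nlinarith
    have hmpos : 0 < m := by linarith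
    have e1 : (v + w) * c.split = v := mul_div_cancel₀ _ hvw.ne'
    have e2 : (v + w) * (1 - c.split) = w := by linear_combination -e1
    have p1 : 0 ≤ c.split := div_nonneg n1 hvw.le
    have p2 : 0 ≤ 1 - c.split := nonneg_of_mul_nonneg_right (e2.symm ▸ n2) hvw
    have hmass : m * (Config.init.val * (1 + 25 / 1000000) ^ (n + 1)) ≤ v + w := by
      refine le_trans ?_ hval
      rw [pow_succ]
      linarith
    split_ifs with hy
    · have h2 : 0 < c.split := pos_of_mul_pos_right (a := m) (by linarith) hmpos.le
      have h3 := mul_le_mul_of_nonneg_right hmass p1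
      refine ⟨?_, hl, hy, ?_⟩
      · exact (mul_pos hvw h2).trans_eq e1
      · change m * c.split * _ ≤ v
        linarith
    · rw [not_lt] at hy
      have h2 : 0 < 1 - c.split := pos_of_mul_pos_right (a := m) (by linarith) hmpos.le
      have h3 := mul_le_mul_of_nonneg_right hmass p2
      refine ⟨?_, hy, ?_, ?_⟩
      · exact (mul_pos hvw h2).trans_eq e2
      · change y < l + m * c.split + m * (1 - c.split)
        linarith
      · change m * (1 - c.split) * _ ≤ w
        linarith

theorem admissible_digitSeq {y : ℝ} (h0 : 0 ≤ y) (h1 : y < 1) : Admissible (digitSeq y) := by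
  refine admissible_of_alive (isDig_digitSeq y) fun n hn => ?_
  have := (coding_spec h0 h1 n).1
  rw [run_digitSeq] at hn
  rw [Config.val, hn] at this
  simp at this

theorem abs_sub_mul_le {y z : ℝ} (hy : y ∈ Set.Ico (0 : ℝ) 1) (hz : z ∈ Set.Ico (0 : ℝ) 1)
    {n : ℕ} (h : ∀ k < n, digitSeq y k = digitSeq z k) :
    |y - z| * (Config.init.val * (1 + 25 / 1000000) ^ n) ≤
      1000000000 * (1 / ((Config.run (digitSeq y) n).den : ℝ)) := by
  have hgood := Config.run_good (isDig_digitSeq y) n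
  refine le_trans ?_ hgood.val_le_inv
  rw [run_digitSeq]
  obtain ⟨-, hl, hr, hm⟩ := coding_spec hy.1 hy.2 n
  obtain ⟨-, hl', hr', -⟩ := coding_spec hz.1 hz.2 n
  rw [← coding_congr h] at hl' hr'
  refine le_trans (mul_le_mul_of_nonneg_right ?_ ?_) hm
  · rw [abs_le]
    constructor <;> linarith
  · have := Config.init_val_pos
    positivity

theorem three_le_one_add_pow {x : ℝ} (hx : 0 ≤ x) {M K : ℕ} (h : 3 ≤ (1 + M * x) ^ K) :
    3 ≤ (1 + x) ^ (M * K) := by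
  rw [pow_mul]
  refine h.trans (pow_le_pow_left₀ (by positivity) ?_ K)
  exact one_add_mul_le_pow (by linarith) M

theorem inv_mul_inv_le_rpow {q t : ℝ} {N n : ℕ} (hN : N ≠ 0) (ht : 0 < t) (hNt : 3 ≤ t ^ N)
    (hq : 0 < q) (h : q ≤ 3 ^ n) :
    1 / q * (t ^ n)⁻¹ ≤ 28 * (1 / (28 * q ^ 2)) ^ (1 / 2 + 1 / (2 * N) : ℝ) := by
  have hN1 : (1 : ℝ) ≤ N := by exact_mod_cast Nat.one_le_iff_ne_zero.2 hN
  have hN2 : 1 / (2 * N : ℝ) ≤ 1 / 2 := one_div_le_one_div_of_le (by norm_num) (by linarith)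
  have e : 1 / (28 * q ^ 2) = 1 / 28 * (1 / q) ^ (2 : ℝ) := by
    rw [Real.rpow_two]
    field_simp
  have e2 : (2 : ℝ) * (1 / 2 + 1 / (2 * N)) = 1 + 1 / N := by
    field_simp
  have h1 : q ^ (1 / N : ℝ) ≤ t ^ n := by
    have : q ≤ (t ^ n) ^ N := by
      rw [← pow_mul, mul_comm, pow_mul]
      exact h.trans (pow_le_pow_left₀ (by norm_num) hNt n)
    refine (Real.rpow_le_rpow hq.le this (by positivity)).trans_eq ?_
    rw [one_div, Real.pow_rpow_inv_natCast (by positivity) hN]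
  have h2 : (t ^ n)⁻¹ ≤ (1 / q) ^ (1 / N : ℝ) := by
    rw [one_div q, Real.inv_rpow hq.le]
    exact inv_anti₀ (by positivity) h1
  have h3 : (1 / 28 : ℝ) ≤ (1 / 28) ^ (1 / 2 + 1 / (2 * N) : ℝ) := by
    refine (Real.rpow_one _).symm.trans_le ?_
    exact Real.rpow_le_rpow_of_exponent_ge (by norm_num) (by norm_num) (by linarith)
  rw [e, Real.mul_rpow (by norm_num) (by positivity), ← Real.rpow_mul (by positivity), e2,
    Real.rpow_add (one_div_pos.2 hq), Real.rpow_one]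
  have h4 := mul_le_mul_of_nonneg_left h2 (by positivity : 0 ≤ 1 / q)
  have h5 : 0 ≤ 1 / q * (1 / q) ^ (1 / N : ℝ) := by positivity
  nlinarith

theorem abs_sub_le_rpow {y z : ℝ} (hy : y ∈ Set.Ico (0 : ℝ) 1) (hz : z ∈ Set.Ico (0 : ℝ) 1) :
    |y - z| ≤ 28000000000 / Config.init.val *
      |cf01 (digitSeq y) - cf01 (digitSeq z)| ^ (1 / 2 + 1 / 96000 : ℝ) := by
  have hv := Config.init_val_pos
  by_cases hne : ∃ n, digitSeq y n ≠ digitSeq z n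
  · classical
    have hn := Nat.find_spec hne
    have hk (k : ℕ) (hk : k < Nat.find hne) : digitSeq y k = digitSeq z k :=
      not_not.1 (Nat.find_min hne hk)
    set n := Nat.find hne
    have h1 := abs_sub_mul_le hy hz hk
    have h2 := le_abs_cf01_sub (isDig_digitSeq y) (isDig_digitSeq z) n hk hn
    have hq : (0 : ℝ) < (Config.run (digitSeq y) n).den := by
      exact_mod_cast (Config.run_good (isDig_digitSeq y) n).pos
    have h3 := inv_mul_inv_le_rpow (q := (Config.run (digitSeq y) n).den)
      (t := 1 + 25 / 1000000) (N := 1000 * 48) (n := n) (by norm_num) (by norm_num)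
      (three_le_one_add_pow (by norm_num) (by norm_num)) hq
      (by exact_mod_cast Config.run_den_le (isDig_digitSeq y) n)
    have e : (1 / 2 + 1 / (2 * ((1000 * 48 : ℕ) : ℝ)) : ℝ) = 1 / 2 + 1 / 96000 := by norm_num
    rw [e] at h3
    set q : ℝ := ((Config.run (digitSeq y) n).den : ℝ)
    have h4 := Real.rpow_le_rpow (by positivity) h2 (by norm_num : (0 : ℝ) ≤ 1 / 2 + 1 / 96000)
    set X := |cf01 (digitSeq y) - cf01 (digitSeq z)| ^ (1 / 2 + 1 / 96000 : ℝ)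
    have ht : (0 : ℝ) < (1 + 25 / 1000000) ^ n := by positivity
    rw [div_mul_eq_mul_div, le_div_iff₀ hv]
    have h5 : |y - z| * Config.init.val ≤
        1000000000 * (1 / q * ((1 + 25 / 1000000) ^ n)⁻¹) := by
      rw [← mul_assoc, ← div_eq_mul_inv, le_div_iff₀ ht]
      linarith
    linarith
  · push Not at hne
    have hyz : |y - z| = 0 := by
      by_contra h0
      have hpos : 0 < |y - z| * Config.init.val :=
        mul_pos (lt_of_le_of_ne (abs_nonneg _) (Ne.symm h0)) hv
      obtain ⟨n, hn⟩ := pow_unbounded_of_one_lt (1000000000 / (|y - z| * Config.init.val))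
        (by norm_num : (1 : ℝ) < 1 + 25 / 1000000)
      have h1 := abs_sub_mul_le hy hz (n := n) fun k _ => hne k
      have hq : (1 : ℝ) ≤ (Config.run (digitSeq y) n).den := by
        exact_mod_cast (Config.run_good (isDig_digitSeq y) n).pos
      have h2 : 1 / ((Config.run (digitSeq y) n).den : ℝ) ≤ 1 :=
        (div_le_one (by linarith)).2 hq
      rw [div_lt_iff₀ hpos] at hn
      linarith
    rw [hyz]
    positivity

theorem le_dimH_of_automaton :
    ENNReal.ofReal (1 / 2 + 1 / 96000) ≤ dimH (gaussCantorRev {1, 2} forbiddenB1) := by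
  set F : ℝ → ℝ := fun y => cf01 (digitSeq y)
  set E : Set ℝ := Set.Ico 0 1
  have hv := Config.init_val_pos
  have hs : (0 : ℝ) < 1 / 2 + 1 / 96000 := by norm_num
  have hinj : Set.InjOn F E := fun y hy z hz hyz => by
    have h := abs_sub_le_rpow hy hz
    change F y = F z at hyz
    rw [show cf01 (digitSeq y) = cf01 (digitSeq z) from hyz, sub_self, abs_zero,
      Real.zero_rpow hs.ne', mul_zero] at h
    exact sub_eq_zero.1 (abs_nonpos_iff.1 h)
  have hg := hinj.leftInvOn_invFunOn
  have hsub : Set.image F E ⊆ gaussCantorRev {1, 2} forbiddenB1 := by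
    rintro _ ⟨y, hy, rfl⟩
    exact mem_gaussCantorRev_iff.2
      ⟨_, isDig_digitSeq y, admissible_digitSeq hy.1 hy.2, rfl⟩
  have hs' : ((1 / 2 + 1 / 96000 : ℝ).toNNReal : ℝ) = 1 / 2 + 1 / 96000 :=
    Real.coe_toNNReal _ hs.le
  have hold : HolderOnWith (28000000000 / Config.init.val).toNNReal
      (1 / 2 + 1 / 96000 : ℝ).toNNReal (Function.invFunOn F E) (Set.image F E) := by
    rintro _ ⟨y, hy, rfl⟩ _ ⟨z, hz, rfl⟩
    rw [hg hy, hg hz, hs', edist_dist, edist_dist, Real.dist_eq, Real.dist_eq,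
      ENNReal.ofReal_rpow_of_nonneg (abs_nonneg _) hs.le]
    change _ ≤ ENNReal.ofReal _ * _
    rw [← ENNReal.ofReal_mul (by positivity)]
    exact ENNReal.ofReal_le_ofReal (abs_sub_le_rpow hy hz)
  have h := hold.dimH_image_le (Real.toNNReal_pos.2 hs)
  rw [hg.image_image] at h
  have hE : dimH E = 1 := by
    rw [Real.dimH_of_nonempty_interior (by rw [interior_Ico]; exact ⟨1 / 2, by norm_num⟩)]
    simp
  rw [hE] at h
  have h1 := ENNReal.mul_le_of_le_div h
  rw [one_mul] at h1
  exact h1.trans (dimH_mono hsub)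

/-- `0.50001 < dim_H B₁ < 0.50005`, where `B₁` is the set of reals whose continued fraction
partial quotients lie in `{1,2}` and avoid the fourteen listed strings and their
reverses. -/
theorem dimH_B1_bounds :
    ENNReal.ofReal 0.50001 < dimH (gaussCantorRev {1, 2} forbiddenB1) ∧
    dimH (gaussCantorRev {1, 2} forbiddenB1) < ENNReal.ofReal 0.50005 := by
  refine ⟨lt_of_lt_of_le ?_ le_dimH_of_automaton, dimH_le_of_automaton.trans_lt ?_⟩
  · exact (ENNReal.ofReal_lt_ofReal_iff (by norm_num)).2 (by norm_num)
  · exact (ENNReal.ofReal_lt_ofReal_iff (by norm_num)).2 (by norm_num)
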